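/- arXiv:2407.19230 — 2 statements merged into one kernel-verified Lean document; each statement's English description precedes it below -/
import Mathlib

section
/- Let k and n be positive integers, let p be a prime number with p ≡ 3 (mod 4), and let r be a nonnegative integer such that p divides 4r + 3. Then B_{3,5}( p^{k+1} n + p r + (3p − 1)/4 ) ≡ −(−5/p)_L · B_{3,5}( p^{k−1} n + (4r + 3 − p)/(4p) ) (mod 3). -/
/-- The number of `t`-regular partitions of `n`, i.e. partitions of `n`
none of whose parts is divisible by `t`. -/
noncomputable def regularPartitionCount (t n : ℕ) : ℕ :=
  Nat.card {π : n.Partition // ∀ x ∈ π.parts, ¬ t ∣ x}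

/-- `B u v n` is the number of `(u,v)`-regular bipartitions of `n`: pairs `(α, β)` of
partitions with `|α| + |β| = n`, `α` being `u`-regular and `β` being `v`-regular. -/
noncomputable def B (u v n : ℕ) : ℕ :=
  ∑ i ∈ Finset.range (n + 1), regularPartitionCount u i * regularPartitionCount v (n - i)

section Auxiliary

open PowerSeries Finset

/-- Reduction of formal power series modulo `X ^ K`. -/
noncomputable abbrev modXPow (R : Type*) [CommRing R] (K : ℕ) :
    R⟦X⟧ →+* R⟦X⟧ ⧸ Ideal.span {(X : R⟦X⟧) ^ K} :=
  Ideal.Quotient.mk _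

/-- The finite Euler product `∏ i < n, (1 - X ^ (t * (i + 1)))`. -/
noncomputable def eulerProd (R : Type*) [CommRing R] (t n : ℕ) : R⟦X⟧ :=
  ∏ i ∈ range n, (1 - X ^ (t * (i + 1)))

/-- The Gaussian binomial coefficient `n` choose `k` in base `q`. -/
def gaussBinom {R : Type*} [CommRing R] (q : R) : ℕ → ℕ → R
  | _, 0 => 1
  | 0, _ + 1 => 0
  | n + 1, k + 1 => gaussBinom q n k + q ^ (k + 1) * gaussBinom q n (k + 1)

section GaussBinom

variable {R : Type*} [CommRing R] (q : R)

theorem gaussBinom_zero_right (n : ℕ) : gaussBinom q n 0 = 1 := by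
  cases n <;> rfl

theorem gaussBinom_eq_zero_of_lt {n k : ℕ} (h : n < k) : gaussBinom q n k = 0 := by
  induction n generalizing k with
  | zero => obtain ⟨k, rfl⟩ := Nat.exists_eq_succ_of_ne_zero h.ne'; rfl
  | succ n ih =>
    obtain ⟨k, rfl⟩ := Nat.exists_eq_succ_of_ne_zero (Nat.ne_zero_of_lt h)
    simp [gaussBinom, ih (show n < k by omega), ih (show n < k + 1 by omega)]

theorem gaussBinom_self (n : ℕ) : gaussBinom q n n = 1 := by
  induction n with
  | zero => rfl
  | succ n ih => simp [gaussBinom, ih, gaussBinom_eq_zero_of_lt q (Nat.lt_succ_self n)]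

/-- The homogeneous `q`-binomial theorem. -/
theorem prod_add_mul_pow_eq_sum_gaussBinom (u v : R) (M : ℕ) :
    ∏ k ∈ range M, (u + v * q ^ k) =
      ∑ j ∈ range (M + 1), gaussBinom q M j * q ^ j.choose 2 * v ^ j * u ^ (M - j) := by
  induction M generalizing v with
  | zero => simp [gaussBinom]
  | succ M ih =>
    have h : ∏ k ∈ range M, (u + v * q ^ (k + 1)) = ∏ k ∈ range M, (u + (v * q) * q ^ k) :=
      prod_congr rfl fun k _ => by ring
    rw [prod_range_succ', h, ih, sum_mul, sum_range_succ' _ (M + 1)]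
    have hs : ∀ j ∈ range (M + 1),
        gaussBinom q (M + 1) (j + 1) * q ^ (j + 1).choose 2 * v ^ (j + 1) * u ^ (M + 1 - (j + 1)) =
        gaussBinom q M j * q ^ j.choose 2 * (v * q) ^ j * u ^ (M - j) * v +
        gaussBinom q M (j + 1) * q ^ (j + 1).choose 2 * (v * q) ^ (j + 1) * u ^ (M - j) := by
      intro j _
      have hc : (j + 1).choose 2 = j + j.choose 2 := by
        rw [Nat.choose_succ_succ' j 1, Nat.choose_one_right]
      rw [Nat.add_sub_add_right, gaussBinom, hc]
      ring
    have hsplit : ∀ j ∈ range (M + 1),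
        gaussBinom q M j * q ^ j.choose 2 * (v * q) ^ j * u ^ (M - j) * (u + v * q ^ 0) =
        gaussBinom q M j * q ^ j.choose 2 * (v * q) ^ j * u ^ (M - j) * v +
        gaussBinom q M j * q ^ j.choose 2 * (v * q) ^ j * u ^ (M - j) * u := by
      intro j _; ring
    rw [sum_congr rfl hsplit, sum_congr rfl hs, sum_add_distrib, sum_add_distrib,
      sum_range_succ (fun j => gaussBinom q M (j + 1) * q ^ (j + 1).choose 2 *
        (v * q) ^ (j + 1) * u ^ (M - j)) M, gaussBinom_eq_zero_of_lt q (Nat.lt_succ_self M),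
      sum_range_succ' (fun j => gaussBinom q M j * q ^ j.choose 2 *
        (v * q) ^ j * u ^ (M - j) * u) M]
    have ht : ∀ j ∈ range M,
        gaussBinom q M (j + 1) * q ^ (j + 1).choose 2 * (v * q) ^ (j + 1) * u ^ (M - (j + 1)) * u =
        gaussBinom q M (j + 1) * q ^ (j + 1).choose 2 * (v * q) ^ (j + 1) * u ^ (M - j) := by
      intro j hj
      have : M - j = M - (j + 1) + 1 := by have := mem_range.1 hj; omega
      rw [this]; ring
    rw [sum_congr rfl ht]
    simp [gaussBinom_zero_right, pow_succ]
    ring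

theorem prod_mul_prod_mul_gaussBinom (a b : ℕ) :
    (∏ i ∈ range a, (1 - q ^ (i + 1))) * (∏ i ∈ range b, (1 - q ^ (i + 1))) *
      gaussBinom q (a + b) a = ∏ i ∈ range (a + b), (1 - q ^ (i + 1)) := by
  induction h : a + b generalizing a b with
  | zero => obtain ⟨rfl, rfl⟩ : a = 0 ∧ b = 0 := by omega
            simp [gaussBinom]
  | succ n ih =>
    match a, b with
    | 0, b => obtain rfl : b = n + 1 := by omega
              simp [gaussBinom]
    | a + 1, 0 => obtain rfl : a = n := by omega
                  simp [gaussBinom_self]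
    | a + 1, b + 1 =>
      have h1 := ih a (b + 1) (by omega)
      have h2 := ih (a + 1) b (by omega)
      obtain rfl : n = a + b + 1 := by omega
      rw [prod_range_succ _ (a + b + 1), gaussBinom]
      rw [prod_range_succ _ b] at h1 ⊢
      rw [prod_range_succ _ a] at h2 ⊢
      linear_combination (1 - q ^ (a + 1)) * h1 + q ^ (a + 1) * (1 - q ^ (b + 1)) * h2

end GaussBinom

section Congruence

variable {R : Type*} [CommRing R]

theorem modXPow_eq_iff {K : ℕ} {f g : R⟦X⟧} : modXPow R K f = modXPow R K g ↔ X ^ K ∣ f - g := by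
  rw [Ideal.Quotient.eq, Ideal.mem_span_singleton]

theorem modXPow_prod_range_eq {K n n' : ℕ} {f : ℕ → R⟦X⟧} (hf : ∀ i, n ≤ i → X ^ K ∣ f i - 1)
    (h : n ≤ n') : modXPow R K (∏ i ∈ range n', f i) = modXPow R K (∏ i ∈ range n, f i) := by
  induction n', h using Nat.le_induction with
  | base => rfl
  | succ m hm ih =>
    rw [prod_range_succ, map_mul, ih, modXPow_eq_iff.2 (hf m hm), map_one, mul_one]

theorem modXPow_hasProd_eq [TopologicalSpace R] [T2Space R] {K n : ℕ} {f : ℕ → R⟦X⟧} {F : R⟦X⟧}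
    (hF : let _ := PowerSeries.WithPiTopology.instTopologicalSpace R; HasProd f F)
    (hf : ∀ i, n ≤ i → X ^ K ∣ f i - 1) :
    modXPow R K F = modXPow R K (∏ i ∈ range n, f i) := by
  let _ := PowerSeries.WithPiTopology.instTopologicalSpace R
  rw [modXPow_eq_iff, X_pow_dvd_iff]
  intro m hm
  have ht := ((PowerSeries.WithPiTopology.continuous_coeff R m).tendsto F).comp
    hF.tendsto_prod_nat
  have hc : ∀ n', n ≤ n' →
      coeff m (∏ i ∈ range n', f i) = coeff m (∏ i ∈ range n, f i) := by
    intro n' hn'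
    have := X_pow_dvd_iff.1 (modXPow_eq_iff.1 (modXPow_prod_range_eq hf hn')) m hm
    rwa [map_sub, sub_eq_zero] at this
  have hu := tendsto_nhds_unique ht
    (tendsto_atTop_of_eventually_const (i₀ := n) fun n' hn' => hc n' hn')
  rw [map_sub, hu, sub_self]

theorem modXPow_eulerProd_eq {K t n n' : ℕ} (h : K ≤ t * (n + 1)) (h' : K ≤ t * (n' + 1)) :
    modXPow R K (eulerProd R t n) = modXPow R K (eulerProd R t n') := by
  have key : ∀ {a b : ℕ}, K ≤ t * (a + 1) → a ≤ b →
      modXPow R K (eulerProd R t b) = modXPow R K (eulerProd R t a) := by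
    intro a b ha hab
    refine modXPow_prod_range_eq (fun i hi => ?_) hab
    rw [sub_sub_cancel_left, dvd_neg]
    exact pow_dvd_pow _ (ha.trans (Nat.mul_le_mul_left _ (by omega)))
  rcases le_total n n' with hn | hn
  · exact (key h hn).symm
  · exact key h' hn

theorem isUnit_eulerProd {t : ℕ} (ht : 0 < t) (n : ℕ) : IsUnit (eulerProd R t n) := by
  rw [isUnit_iff_constantCoeff, eulerProd, map_prod]
  simp [ht.ne']

end Congruence

section TripleProduct

/-- The exponent of the `j`-th term of the theta series
`∑ j, (-1) ^ j * X ^ (5 * j * (j - 1) / 2 + a * j)`. -/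
def thetaExp (a : ℕ) (j : ℤ) : ℕ := ((5 * j * (j - 1) + 2 * a * j) / 2).toNat

theorem two_mul_thetaExp {a : ℕ} (ha : 0 < a) (ha5 : a < 5) (j : ℤ) :
    2 * (thetaExp a j : ℤ) = 5 * j * (j - 1) + 2 * a * j := by
  have hnn : 0 ≤ 5 * j * (j - 1) + 2 * a * j := by
    have h1 : (1 : ℤ) ≤ a := by exact_mod_cast ha
    have h2 : (a : ℤ) ≤ 4 := by exact_mod_cast Nat.le_of_lt_succ ha5
    rcases le_or_gt 0 j with hj | hj
    · rcases eq_or_lt_of_le hj with rfl | hj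
      · simp
      · nlinarith [mul_nonneg (show 0 ≤ j by omega) (show 0 ≤ j - 1 by omega)]
    · nlinarith
  have hev : 2 ∣ 5 * j * (j - 1) + 2 * a * j := by
    refine dvd_add ?_ (by rw [mul_assoc]; exact dvd_mul_right _ _)
    rw [mul_assoc, ← even_iff_two_dvd]
    exact (Int.even_mul_pred_self j).mul_left 5
  rw [thetaExp, Int.toNat_of_nonneg (Int.ediv_nonneg hnn (by norm_num)), Int.mul_ediv_cancel' hev]

theorem natAbs_le_thetaExp {a : ℕ} (ha : 0 < a) (ha5 : a < 5) (j : ℤ) :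
    j.natAbs ≤ thetaExp a j := by
  have h := two_mul_thetaExp ha ha5 j
  have h1 : (1 : ℤ) ≤ a := by exact_mod_cast ha
  have h2 : (a : ℤ) ≤ 4 := by exact_mod_cast Nat.le_of_lt_succ ha5
  rcases le_or_gt 0 j with hj | hj
  · rcases eq_or_lt_of_le hj with rfl | hj
    · simp
    · have : j ≤ thetaExp a j := by
        nlinarith [mul_nonneg (show 0 ≤ j by omega) (show 0 ≤ j - 1 by omega)]
      omega
  · have : -j ≤ thetaExp a j := by nlinarith
    omega

theorem five_mul_natAbs_le_thetaExp_add {a : ℕ} (ha : 0 < a) (ha5 : a < 5) (j : ℤ) :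
    5 * j.natAbs ≤ thetaExp a j + 4 := by
  have h := two_mul_thetaExp ha ha5 j
  have h1 : (1 : ℤ) ≤ a := by exact_mod_cast ha
  have h2 : (a : ℤ) ≤ 4 := by exact_mod_cast Nat.le_of_lt_succ ha5
  rcases le_or_gt 0 j with hj | hj
  · rcases eq_or_lt_of_le hj with rfl | hj
    · simp
    · have : 5 * j ≤ thetaExp a j + 4 := by
        nlinarith [mul_nonneg (show 0 ≤ j - 1 by omega) (show 0 ≤ (a : ℤ) - 1 by omega),
          mul_self_nonneg (j - 2), mul_self_nonneg (j - 1)]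
      omega
  · have : 5 * -j ≤ thetaExp a j + 4 := by
      rcases eq_or_lt_of_le (show j ≤ -1 by omega) with rfl | hj'
      · push_cast at h ⊢; linarith
      · nlinarith [mul_nonneg (show 0 ≤ -1 - j by omega) (show 0 ≤ 4 - (a : ℤ) by omega)]
    omega

theorem two_mul_choose_two_cast (n : ℕ) : 2 * (n.choose 2 : ℤ) = n * (n - 1) := by
  induction n with
  | zero => simp
  | succ n ih =>
    rw [Nat.choose_succ_succ' n 1, Nat.choose_one_right]
    push_cast
    linarith

variable {R : Type*} [CommRing R]

theorem prod_X_pow_add_five_mul (a n : ℕ) :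
    ∏ k ∈ range n, (X : R⟦X⟧) ^ (a + 5 * k) = X ^ (a * n + 5 * n.choose 2) := by
  induction n with
  | zero => simp
  | succ n ih =>
    rw [prod_range_succ, ih, ← pow_add, Nat.choose_succ_succ' n 1, Nat.choose_one_right]
    ring_nf

/-- A finite form of the Jacobi triple product identity. -/
theorem prod_mul_prod_eq_sum_gaussBinom {a b : ℕ} (ha : 0 < a) (hb : 0 < b)
    (hab : a + b = 5) (N : ℕ) :
    (∏ k ∈ range N, (1 - (X : R⟦X⟧) ^ (a + 5 * k))) * ∏ k ∈ range N, (1 - X ^ (b + 5 * k)) =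
      ∑ i ∈ range (2 * N + 1),
        (-1) ^ (N + i) * X ^ thetaExp a (i - N) * gaussBinom (X ^ 5) (2 * N) i := by
  set C := a * N + 5 * N.choose 2 + 5 * N * N with hC
  refine (isUnit_one.neg.pow N).mul_left_cancel (X_pow_mul_cancel (k := C) ?_)
  have key := prod_add_mul_pow_eq_sum_gaussBinom ((X : R⟦X⟧) ^ 5) (X ^ (5 * N)) (-X ^ a) (2 * N)
  have h1 : ∏ k ∈ range N, ((X : R⟦X⟧) ^ (5 * N) + -X ^ a * (X ^ 5) ^ k) =
      (-1) ^ N * X ^ (a * N + 5 * N.choose 2) * ∏ k ∈ range N, (1 - X ^ (b + 5 * k)) := by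
    have h : ∀ k ∈ range N, (X : R⟦X⟧) ^ (5 * N) + -X ^ a * (X ^ 5) ^ k =
        (-1) * X ^ (a + 5 * k) * (1 - X ^ (b + 5 * (N - 1 - k))) := by
      intro k hk
      have hk := mem_range.1 hk
      have : 5 * N = a + 5 * k + (b + 5 * (N - 1 - k)) := by omega
      rw [this, pow_add X (a + 5 * k) (b + 5 * (N - 1 - k))]
      ring
    rw [prod_congr rfl h, prod_mul_distrib, prod_mul_distrib, prod_X_pow_add_five_mul,
      prod_range_reflect (fun k => (1 : R⟦X⟧) - X ^ (b + 5 * k)) N]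
    simp
  have h2 : ∏ k ∈ range N, ((X : R⟦X⟧) ^ (5 * N) + -X ^ a * (X ^ 5) ^ (N + k)) =
      X ^ (5 * N * N) * ∏ k ∈ range N, (1 - X ^ (a + 5 * k)) := by
    have h : ∀ k ∈ range N, (X : R⟦X⟧) ^ (5 * N) + -X ^ a * (X ^ 5) ^ (N + k) =
        X ^ (5 * N) * (1 - X ^ (a + 5 * k)) := fun k _ => by ring
    rw [prod_congr rfl h, prod_mul_distrib]
    simp [pow_mul]
  rw [two_mul N, prod_range_add, h1, h2, ← two_mul] at key
  rw [mul_sum, mul_sum]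
  calc _ = _ := by rw [hC]; ring
    _ = _ := key
    _ = _ := sum_congr rfl fun i hi => ?_
  have hi : i ≤ 2 * N := Nat.lt_succ_iff.1 (mem_range.1 hi)
  have hexp : 5 * i.choose 2 + a * i + 5 * N * (2 * N - i) =
      C + thetaExp a (i - N) := by
    have e1 := two_mul_choose_two_cast i
    have e2 := two_mul_choose_two_cast N
    have e3 := two_mul_thetaExp ha (show a < 5 by omega) ((i : ℤ) - N)
    rw [hC]
    zify [hi]
    linarith
  have hsgn : ((-1) ^ N * (-1) ^ (N + i) : R⟦X⟧) = (-1) ^ i := by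
    rw [← pow_add, ← add_assoc, pow_add, Even.neg_one_pow ⟨N, rfl⟩, one_mul]
  calc gaussBinom (X ^ 5) (2 * N) i * (X ^ 5) ^ i.choose 2 * (-X ^ a) ^ i *
        (X ^ (5 * N)) ^ (2 * N - i)
      = (-1) ^ i * X ^ (5 * i.choose 2 + a * i + 5 * N * (2 * N - i)) *
          gaussBinom ((X : R⟦X⟧) ^ 5) (2 * N) i := by
        rw [neg_pow, pow_add, pow_add, pow_mul, pow_mul X a i, pow_mul X (5 * N)]; ring
    _ = _ := by rw [hexp, ← hsgn, pow_add X _ (thetaExp a (i - N))]; ring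

theorem modXPow_eulerProd_mul_gaussBinom {N i : ℕ} (hi : i ≤ 2 * N) :
    modXPow R (5 * (min i (2 * N - i) + 1)) (eulerProd R 5 N * gaussBinom (X ^ 5) (2 * N) i) =
      1 := by
  set K := 5 * (min i (2 * N - i) + 1) with hK
  have h : eulerProd R 5 i * eulerProd R 5 (2 * N - i) * gaussBinom (X ^ 5) (2 * N) i =
      eulerProd R 5 (2 * N) := by
    have := prod_mul_prod_mul_gaussBinom ((X : R⟦X⟧) ^ 5) i (2 * N - i)
    rw [Nat.add_sub_cancel' hi] at this
    simpa only [eulerProd, pow_mul] using this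
  have h' := congrArg (modXPow R K) h
  rw [map_mul, map_mul, modXPow_eulerProd_eq (n := i) (n' := N) (by omega) (by omega),
    modXPow_eulerProd_eq (n := 2 * N - i) (n' := N) (by omega) (by omega),
    modXPow_eulerProd_eq (n := 2 * N) (n' := N) (by omega) (by omega), mul_assoc] at h'
  rw [map_mul]
  exact ((isUnit_eulerProd (R := R) (t := 5) (by norm_num) N).map (modXPow R K)).mul_left_cancel
    (h'.trans (mul_one _).symm)

theorem sum_Icc_neg_eq_sum_range {M : Type*} [AddCommMonoid M] (N : ℕ) (f : ℤ → M) :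
    ∑ j ∈ Icc (-N : ℤ) N, f j = ∑ i ∈ range (2 * N + 1), f (i - N) := by
  symm
  refine sum_bij (fun i _ => (i : ℤ) - N) ?_ ?_ ?_ fun _ _ => rfl
  · intro i hi
    have := mem_range.1 hi
    rw [mem_Icc]; omega
  · intro i _ j _ h
    simpa using h
  · intro j hj
    have := mem_Icc.1 hj
    exact ⟨(j + N).toNat, mem_range.2 (by omega), by omega⟩

/-- The Jacobi triple product identity in base `X ^ 5`, modulo `X ^ (N + 1)`. -/
theorem modXPow_triple_product {a b : ℕ} (ha : 0 < a) (hb : 0 < b)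
    (hab : a + b = 5) (N : ℕ) :
    modXPow R (N + 1) ((∏ k ∈ range N, (1 - X ^ (a + 5 * k))) *
      (∏ k ∈ range N, (1 - X ^ (b + 5 * k))) * eulerProd R 5 N) =
    modXPow R (N + 1) (∑ j ∈ Icc (-N : ℤ) N,
      (((j.negOnePow : ℤˣ) : ℤ) : R⟦X⟧) * X ^ thetaExp a j) := by
  rw [prod_mul_prod_eq_sum_gaussBinom ha hb hab, sum_Icc_neg_eq_sum_range, sum_mul, map_sum,
    map_sum]
  refine sum_congr rfl fun i hi => ?_
  have hi : i ≤ 2 * N := Nat.lt_succ_iff.1 (mem_range.1 hi)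
  have hsgn : ((((((i : ℤ) - N).negOnePow : ℤˣ) : ℤ)) : R⟦X⟧) = (-1) ^ (N + i) := by
    rw [Int.negOnePow_sub, ← Int.negOnePow_add, ← Nat.cast_add, add_comm i, Int.coe_negOnePow_natCast]
    simp
  have h1 := modXPow_eulerProd_mul_gaussBinom (R := R) hi
  rw [← map_one (modXPow R _), modXPow_eq_iff] at h1
  have hle : N + 1 ≤ thetaExp a (i - N) + 5 * (min i (2 * N - i) + 1) := by
    have := five_mul_natAbs_le_thetaExp_add ha (show a < 5 by omega) ((i : ℤ) - N)
    omega
  rw [hsgn, modXPow_eq_iff]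
  have h2 := (pow_dvd_pow (X : R⟦X⟧) hle).trans
    ((pow_add X _ _).dvd.trans (mul_dvd_mul_left (X ^ thetaExp a (i - N)) h1))
  convert h2.mul_left ((-1) ^ (N + i)) using 1
  ring

end TripleProduct

section GeneratingFunction

theorem regularPartitionCount_eq_card_countRestricted {t : ℕ} (ht : 0 < t) (n : ℕ) :
    regularPartitionCount t n = #(Nat.Partition.countRestricted n t) := by
  rw [← Nat.Partition.card_restricted_eq_card_countRestricted n ht, regularPartitionCount,
    Nat.card_eq_fintype_card, Fintype.card_subtype]
  rfl

/-- The generating function of `t`-regular partitions is `∏ (1 - X ^ (t * i)) / ∏ (1 - X ^ i)`. -/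
theorem modXPow_mk_regularPartitionCount_mul {R : Type*} [CommRing R] {t : ℕ} (ht : 0 < t)
    {K n : ℕ} (hK : K ≤ n + 1) :
    modXPow R K (PowerSeries.mk fun m => (regularPartitionCount t m : R)) *
      modXPow R K (eulerProd R 1 n) = modXPow R K (eulerProd R t n) := by
  let _ : TopologicalSpace R := ⊥
  have _ : DiscreteTopology R := ⟨rfl⟩
  simp_rw [regularPartitionCount_eq_card_countRestricted ht]
  rw [modXPow_hasProd_eq (n := n)
    (Nat.Partition.hasProd_powerSeriesMk_card_countRestricted R ht), ← map_mul, eulerProd,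
    ← prod_mul_distrib]
  · congr 1
    refine prod_congr rfl fun i _ => ?_
    simp_rw [pow_mul]
    rw [pow_one, geom_sum_mul_neg, ← pow_mul, ← pow_mul, mul_comm]
  · intro i hi
    obtain ⟨s, rfl⟩ := Nat.exists_eq_succ_of_ne_zero ht.ne'
    rw [Nat.succ_eq_add_one, sum_range_succ', mul_zero, pow_zero, add_sub_cancel_right]
    refine dvd_sum fun j _ => pow_dvd_pow _ ?_
    nlinarith

theorem mk_B (R : Type*) [CommRing R] (u v : ℕ) :
    (PowerSeries.mk fun n => (B u v n : R)) =
      (PowerSeries.mk fun n => (regularPartitionCount u n : R)) *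
        PowerSeries.mk fun n => (regularPartitionCount v n : R) := by
  ext n
  rw [coeff_mul, coeff_mk, Nat.sum_antidiagonal_eq_sum_range_succ_mk, B]
  simp

theorem eulerProd_three (n : ℕ) : eulerProd (ZMod 3) 3 n = eulerProd (ZMod 3) 1 n ^ 3 := by
  have : CharP (ZMod 3)⟦X⟧ 3 := charP_of_injective_algebraMap
    (algebraMap (ZMod 3) (ZMod 3)⟦X⟧).injective 3
  rw [eulerProd, eulerProd, ← prod_pow]
  refine prod_congr rfl fun i _ => ?_
  rw [sub_pow_char, one_pow, ← pow_mul, one_mul, mul_comm]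

theorem modXPow_mk_B_three_five {K n : ℕ} (hK : K ≤ n + 1) :
    modXPow (ZMod 3) K (PowerSeries.mk fun m => (B 3 5 m : ZMod 3)) =
      modXPow (ZMod 3) K (eulerProd (ZMod 3) 1 n * eulerProd (ZMod 3) 5 n) := by
  have h3 := modXPow_mk_regularPartitionCount_mul (R := ZMod 3) (t := 3) (by norm_num) hK
  have h5 := modXPow_mk_regularPartitionCount_mul (R := ZMod 3) (t := 5) (by norm_num) hK
  have hu := ((isUnit_eulerProd (R := ZMod 3) one_pos n).map (modXPow (ZMod 3) K)).pow 2
  refine hu.mul_right_cancel ?_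
  rw [eulerProd_three, map_pow] at h3
  rw [mk_B, map_mul, map_mul]
  linear_combination (modXPow (ZMod 3) K (PowerSeries.mk fun m =>
    (regularPartitionCount 5 m : ZMod 3))) * modXPow (ZMod 3) K (eulerProd (ZMod 3) 1 n) * h3 +
    modXPow (ZMod 3) K (eulerProd (ZMod 3) 1 n) ^ 3 * h5

theorem eulerProd_one_five_mul (R : Type*) [CommRing R] (N : ℕ) :
    eulerProd R 1 (5 * N) =
      (∏ k ∈ range N, (1 - X ^ (1 + 5 * k))) * (∏ k ∈ range N, (1 - X ^ (4 + 5 * k))) *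
      ((∏ k ∈ range N, (1 - X ^ (2 + 5 * k))) * ∏ k ∈ range N, (1 - X ^ (3 + 5 * k))) *
      eulerProd R 5 N := by
  induction N with
  | zero => simp [eulerProd]
  | succ N ih =>
    have h : eulerProd R 1 (5 * (N + 1)) = eulerProd R 1 (5 * N) * (1 - X ^ (1 + 5 * N)) *
        (1 - X ^ (2 + 5 * N)) * (1 - X ^ (3 + 5 * N)) * (1 - X ^ (4 + 5 * N)) *
        (1 - X ^ (5 * (N + 1))) := by
      simp only [eulerProd, mul_add 5 N 1, prod_range_succ, mul_one, one_mul]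
      ring
    have h5 : eulerProd R 5 (N + 1) = eulerProd R 5 N * (1 - X ^ (5 * (N + 1))) :=
      prod_range_succ _ _
    rw [h, h5, ih]
    simp only [prod_range_succ]
    ring

/-- The pairs `(i, j)` indexing the terms of degree `m` in the product of the two theta series. -/
noncomputable def thetaPairs (m : ℕ) : Finset (ℤ × ℤ) :=
  {x ∈ Icc (-m : ℤ) m ×ˢ Icc (-m : ℤ) m | thetaExp 1 x.1 + thetaExp 2 x.2 = m}

theorem B_three_five_eq_sum (m : ℕ) :
    (B 3 5 m : ZMod 3) =
      ((∑ x ∈ thetaPairs m, (((x.1 + x.2).negOnePow : ℤˣ) : ℤ) : ℤ) : ZMod 3) := by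
  have h1 := modXPow_triple_product (R := ZMod 3) (a := 1) (b := 4) (by norm_num) (by norm_num)
    (by norm_num) m
  have h2 := modXPow_triple_product (R := ZMod 3) (a := 2) (b := 3) (by norm_num) (by norm_num)
    (by norm_num) m
  have h3 := modXPow_mk_B_three_five (K := m + 1) (n := 5 * m) (by omega)
  rw [map_mul, modXPow_eulerProd_eq (t := 5) (n := 5 * m) (n' := m) (by omega) (by omega),
    ← map_mul, eulerProd_one_five_mul] at h3
  have h4 := congrArg₂ (· * ·) h1 h2
  simp only [← map_mul] at h4
  have h5 := h3.trans (Eq.trans (by congr 1; ring) h4)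
  have h6 := X_pow_dvd_iff.1 (modXPow_eq_iff.1 h5) m (Nat.lt_succ_self m)
  rw [map_sub, sub_eq_zero, coeff_mk] at h6
  rw [h6, sum_mul_sum, ← sum_product', map_sum, thetaPairs, sum_filter, Int.cast_sum]
  refine sum_congr rfl fun x _ => ?_
  rw [Int.negOnePow_add, mul_mul_mul_comm, ← pow_add, ← Int.cast_mul, ← Units.val_mul,
    ← map_intCast (C (R := ZMod 3)), coeff_C_mul_X_pow]
  simp only [eq_comm (a := m)]
  split_ifs <;> simp

end GeneratingFunction

section ThetaPairs

theorem mem_thetaPairs {m : ℕ} {x : ℤ × ℤ} :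
    x ∈ thetaPairs m ↔ (10 * x.1 - 3) ^ 2 + (10 * x.2 - 1) ^ 2 = 40 * (m : ℤ) + 10 := by
  have h1 := two_mul_thetaExp (a := 1) (by norm_num) (by norm_num) x.1
  have h2 := two_mul_thetaExp (a := 2) (by norm_num) (by norm_num) x.2
  have b1 := natAbs_le_thetaExp (a := 1) (by norm_num) (by norm_num) x.1
  have b2 := natAbs_le_thetaExp (a := 2) (by norm_num) (by norm_num) x.2
  push_cast at h1 h2
  rw [thetaPairs, mem_filter, mem_product, mem_Icc, mem_Icc]
  constructor
  · rintro ⟨-, h⟩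
    zify at h
    linarith
  · intro h
    have h3 : (thetaExp 1 x.1 : ℤ) + thetaExp 2 x.2 = m := by linarith
    norm_cast at h3
    refine ⟨⟨⟨?_, ?_⟩, ?_, ?_⟩, h3⟩ <;> omega

theorem Int.dvd_and_dvd_of_dvd_sq_add_sq {p : ℕ} (hp : p.Prime) (hp3 : p % 4 = 3) {x y : ℤ}
    (h : (p : ℤ) ∣ x ^ 2 + y ^ 2) : (p : ℤ) ∣ x ∧ (p : ℤ) ∣ y := by
  have : Fact p.Prime := ⟨hp⟩
  have h0 : ((x : ZMod p)) ^ 2 + (y : ZMod p) ^ 2 = 0 := by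
    have := (ZMod.intCast_zmod_eq_zero_iff_dvd _ p).2 h
    exact_mod_cast this
  constructor <;> rw [← ZMod.intCast_zmod_eq_zero_iff_dvd] <;> by_contra hne
  · exact ZMod.mod_four_ne_three_of_sq_eq_neg_sq hne (eq_neg_of_add_eq_zero_left h0) hp3
  · exact ZMod.mod_four_ne_three_of_sq_eq_neg_sq' hne (eq_neg_of_add_eq_zero_left h0) hp3

theorem sum_thetaPairs_eq_of_map {p : ℕ} (hp : p.Prime) (hp3 : p % 4 = 3) {m M : ℕ}
    (hM : 4 * M + 1 = p ^ 2 * (4 * m + 1)) (F : ℤ × ℤ → ℤ × ℤ) (ε : ℤ)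
    (hinj : Function.Injective F)
    (hnorm : ∀ x, (10 * (F x).1 - 3) ^ 2 + (10 * (F x).2 - 1) ^ 2 =
      (p : ℤ) ^ 2 * ((10 * x.1 - 3) ^ 2 + (10 * x.2 - 1) ^ 2))
    (hsurj : ∀ y : ℤ × ℤ, (p : ℤ) ∣ 10 * y.1 - 3 → (p : ℤ) ∣ 10 * y.2 - 1 → ∃ x, F x = y)
    (hsgn : ∀ x, ((((F x).1 + (F x).2).negOnePow : ℤˣ) : ℤ) =
      ε * (((x.1 + x.2).negOnePow : ℤˣ) : ℤ)) :
    ∑ x ∈ thetaPairs M, (((x.1 + x.2).negOnePow : ℤˣ) : ℤ) =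
      ε * ∑ x ∈ thetaPairs m, (((x.1 + x.2).negOnePow : ℤˣ) : ℤ) := by
  have hM' : 40 * (M : ℤ) + 10 = p ^ 2 * (40 * m + 10) := by
    have : (4 * M + 1 : ℤ) = p ^ 2 * (4 * m + 1) := by exact_mod_cast hM
    linarith
  have hp0 : (p : ℤ) ^ 2 ≠ 0 := pow_ne_zero _ (by exact_mod_cast hp.ne_zero)
  have hiff : ∀ x, F x ∈ thetaPairs M ↔ x ∈ thetaPairs m := fun x => by
    rw [mem_thetaPairs, mem_thetaPairs, hnorm, hM', mul_right_inj' hp0]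
  rw [mul_sum]
  symm
  refine sum_bij (fun x _ => F x) (fun x hx => (hiff x).2 hx) (fun x _ y _ h => hinj h) ?_
    fun x _ => (hsgn x).symm
  intro y hy
  have hdvd : (p : ℤ) ∣ (10 * y.1 - 3) ^ 2 + (10 * y.2 - 1) ^ 2 := by
    rw [mem_thetaPairs.1 hy, hM', sq, mul_assoc]
    exact dvd_mul_right _ _
  obtain ⟨hU, hV⟩ := Int.dvd_and_dvd_of_dvd_sq_add_sq hp hp3 hdvd
  obtain ⟨x, rfl⟩ := hsurj y hU hV
  exact ⟨x, (hiff x).1 hy, rfl⟩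

theorem sum_thetaPairs_mul_sq_of_mod_one_or_nine {p : ℕ} (hp : p.Prime) (hp3 : p % 4 = 3)
    (h : p % 10 = 1 ∨ p % 10 = 9) {m M : ℕ} (hM : 4 * M + 1 = p ^ 2 * (4 * m + 1)) :
    ∑ x ∈ thetaPairs M, (((x.1 + x.2).negOnePow : ℤˣ) : ℤ) =
      ∑ x ∈ thetaPairs m, (((x.1 + x.2).negOnePow : ℤˣ) : ℤ) := by
  obtain ⟨s, t, hs, hpt⟩ : ∃ s t : ℤ, (s = 1 ∨ s = -1) ∧ s * p = 10 * t + 1 := by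
    rcases h with h | h
    · exact ⟨1, p / 10, Or.inl rfl, by omega⟩
    · exact ⟨-1, -(p / 10) - 1, Or.inr rfl, by omega⟩
  have hs2 : s ^ 2 = 1 := by rcases hs with rfl | rfl <;> norm_num
  have hsp : s * (p : ℤ) ≠ 0 := by omega
  rw [sum_thetaPairs_eq_of_map hp hp3 hM
    (fun x => (s * p * x.1 - 3 * t, s * p * x.2 - t)) 1, one_mul]
  · rintro ⟨a, b⟩ ⟨c, d⟩ h
    have h1 : a = c := by simpa [hsp] using congrArg Prod.fst h
    have h2 : b = d := by simpa [hsp] using congrArg Prod.snd h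
    rw [h1, h2]
  · rintro ⟨a, b⟩
    have e1 : 10 * (s * p * a - 3 * t) - 3 = s * p * (10 * a - 3) := by
      linear_combination 3 * hpt
    have e2 : 10 * (s * p * b - t) - 1 = s * p * (10 * b - 1) := by linear_combination hpt
    simp only [e1, e2]
    linear_combination (p : ℤ) ^ 2 * ((10 * a - 3) ^ 2 + (10 * b - 1) ^ 2) * hs2
  · rintro ⟨a, b⟩ ⟨U, hU⟩ ⟨V, hV⟩
    have hU' : 10 * a - 3 = s * U + 10 * (t * (s * U)) := by
      linear_combination hU - p * U * hs2 + s * U * hpt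
    have hV' : 10 * b - 1 = s * V + 10 * (t * (s * V)) := by
      linear_combination hV - p * V * hs2 + s * V * hpt
    refine ⟨(a - t * (s * U), b - t * (s * V)), Prod.ext ?_ ?_⟩
    · simp only [hpt]
      linear_combination t * hU'
    · simp only [hpt]
      linear_combination t * hV'
  · rintro ⟨a, b⟩
    rw [one_mul, Units.val_inj, Int.negOnePow_eq_iff]
    exact ⟨5 * t * (a + b) - 2 * t, by linear_combination (a + b) * hpt⟩

theorem sum_thetaPairs_mul_sq_of_mod_three_or_seven {p : ℕ} (hp : p.Prime) (hp3 : p % 4 = 3)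
    (h : p % 10 = 3 ∨ p % 10 = 7) {m M : ℕ} (hM : 4 * M + 1 = p ^ 2 * (4 * m + 1)) :
    ∑ x ∈ thetaPairs M, (((x.1 + x.2).negOnePow : ℤˣ) : ℤ) =
      -∑ x ∈ thetaPairs m, (((x.1 + x.2).negOnePow : ℤˣ) : ℤ) := by
  obtain ⟨s, t, hs, hpt⟩ : ∃ s t : ℤ, (s = 1 ∨ s = -1) ∧ s * p = 10 * t + 3 := by
    rcases h with h | h
    · exact ⟨1, p / 10, Or.inl rfl, by omega⟩
    · exact ⟨-1, -(p / 10) - 1, Or.inr rfl, by omega⟩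
  have hs2 : s ^ 2 = 1 := by rcases hs with rfl | rfl <;> norm_num
  have hsp : s * (p : ℤ) ≠ 0 := by omega
  rw [sum_thetaPairs_eq_of_map hp hp3 hM
    (fun x => (s * p * x.2 - t, -(s * p * x.1) + 3 * t + 1)) (-1), neg_one_mul]
  · rintro ⟨a, b⟩ ⟨c, d⟩ h
    have h1 : b = d := by simpa [hsp] using congrArg Prod.fst h
    have h2 : a = c := by simpa [hsp] using congrArg Prod.snd h
    rw [h1, h2]
  · rintro ⟨a, b⟩
    have e1 : 10 * (s * p * b - t) - 3 = s * p * (10 * b - 1) := by linear_combination hpt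
    have e2 : 10 * (-(s * p * a) + 3 * t + 1) - 1 = -(s * p * (10 * a - 3)) := by
      linear_combination -3 * hpt
    simp only [e1, e2]
    linear_combination (p : ℤ) ^ 2 * ((10 * a - 3) ^ 2 + (10 * b - 1) ^ 2) * hs2
  · rintro ⟨a, b⟩ ⟨U, hU⟩ ⟨V, hV⟩
    have hU' : 10 * a - 3 = 3 * (s * U) + 10 * (t * (s * U)) := by
      linear_combination hU - p * U * hs2 + s * U * hpt
    have hV' : 10 * b - 1 = 3 * (s * V) + 10 * (t * (s * V)) := by
      linear_combination hV - p * V * hs2 + s * V * hpt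
    obtain ⟨c, hc⟩ : ∃ c, s * U = 10 * c - 1 := ⟨(s * U + 1) / 10, by omega⟩
    obtain ⟨d, hd⟩ : ∃ d, -(s * V) = 10 * d - 3 := ⟨(-(s * V) + 3) / 10, by omega⟩
    refine ⟨(d, c), Prod.ext ?_ ?_⟩
    · simp only [hpt]
      have : 10 * ((10 * t + 3) * c - t) = 10 * a := by
        linear_combination -hU' - (10 * t + 3) * hc
      linarith
    · simp only [hpt]
      have : 10 * (-((10 * t + 3) * d) + 3 * t + 1) = 10 * b := by
        linear_combination -hV' + (10 * t + 3) * hd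
      linarith
  · rintro ⟨a, b⟩
    rw [neg_one_mul, ← Units.val_neg, Units.val_inj, ← Int.negOnePow_succ, Int.negOnePow_eq_iff]
    exact ⟨5 * t * (b - a) + t + b - 2 * a, by linear_combination (b - a) * hpt⟩

theorem neg_legendreSym_neg_five {p : ℕ} [Fact p.Prime] [Fact (Nat.Prime 5)]
    (hp3 : p % 4 = 3) :
    -legendreSym p (-5) = legendreSym 5 p := by
  have h2 : p ≠ 2 := by rintro rfl; norm_num at hp3
  have h : legendreSym 5 p = legendreSym p (5 : ℕ) :=
    (legendreSym.quadratic_reciprocity_one_mod_four (p := 5) (q := p) (by norm_num) h2).symm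
  rw [h, neg_eq_neg_one_mul (5 : ℤ), legendreSym.mul, legendreSym.at_neg_one h2,
    ZMod.χ₄_nat_three_mod_four hp3]
  simp

theorem legendreSym_five_eq {p : ℕ} [Fact (Nat.Prime 5)] :
    legendreSym 5 p = legendreSym 5 (p % 5 : ℕ) := by
  rw [legendreSym.mod, ← Int.natCast_mod]

theorem sum_thetaPairs_mul_sq {p : ℕ} [Fact p.Prime] (hp3 : p % 4 = 3) {m M : ℕ}
    (hM : 4 * M + 1 = p ^ 2 * (4 * m + 1)) :
    ∑ x ∈ thetaPairs M, (((x.1 + x.2).negOnePow : ℤˣ) : ℤ) =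
      -legendreSym p (-5) * ∑ x ∈ thetaPairs m, (((x.1 + x.2).negOnePow : ℤˣ) : ℤ) := by
  have hp : p.Prime := Fact.out
  have h5 : p % 5 ≠ 0 := fun h => by
    have := (Nat.prime_dvd_prime_iff_eq Nat.prime_five hp).1 (Nat.dvd_of_mod_eq_zero h)
    omega
  have : Fact (Nat.Prime 5) := ⟨by norm_num⟩
  rw [neg_legendreSym_neg_five hp3, legendreSym_five_eq]
  obtain h | h | h | h : p % 5 = 1 ∨ p % 5 = 4 ∨ p % 5 = 2 ∨ p % 5 = 3 := by omega
  · rw [sum_thetaPairs_mul_sq_of_mod_one_or_nine hp hp3 (by omega) hM, h,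
      show @legendreSym 5 ⟨Nat.prime_five⟩ (1 : ℕ) = 1 by decide, one_mul]
  · rw [sum_thetaPairs_mul_sq_of_mod_one_or_nine hp hp3 (by omega) hM, h,
      show @legendreSym 5 ⟨Nat.prime_five⟩ (4 : ℕ) = 1 by decide, one_mul]
  · rw [sum_thetaPairs_mul_sq_of_mod_three_or_seven hp hp3 (by omega) hM, h,
      show @legendreSym 5 ⟨Nat.prime_five⟩ (2 : ℕ) = -1 by decide, neg_one_mul]
  · rw [sum_thetaPairs_mul_sq_of_mod_three_or_seven hp hp3 (by omega) hM, h,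
      show @legendreSym 5 ⟨Nat.prime_five⟩ (3 : ℕ) = -1 by decide, neg_one_mul]

end ThetaPairs

end Auxiliary

/-- Theorem 1.5(ii): a multiplicative formula for `B 3 5` modulo 3. -/
theorem B_3_5_mult (k n : ℕ) (hk : 0 < k) (hn : 0 < n) (p : ℕ) (hp : p.Prime)
    (hp3 : p % 4 = 3) (r : ℕ) (hr : p ∣ 4 * r + 3) :
    (B 3 5 (p ^ (k + 1) * n + p * r + (3 * p - 1) / 4) : ℤ)
      ≡ -(@legendreSym p ⟨hp⟩ (-5))
          * (B 3 5 (p ^ (k - 1) * n + (4 * r + 3 - p) / (4 * p)) : ℤ) [ZMOD 3] := by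
  have : Fact p.Prime := ⟨hp⟩
  obtain ⟨j, rfl⟩ := Nat.exists_eq_succ_of_ne_zero hk.ne'
  obtain ⟨s, hs⟩ := hr
  have hs4 : s % 4 = 1 := by
    have h := congrArg (· % 4) hs
    simp only [Nat.mul_mod p s, hp3] at h
    have := Nat.mod_lt s (show 0 < 4 by norm_num)
    interval_cases s % 4 <;> omega
  obtain ⟨w, rfl⟩ : ∃ w, s = 4 * w + 1 := ⟨s / 4, by omega⟩
  have hdiv : (4 * r + 3 - p) / (4 * p) = w := by
    rw [hs, show p * (4 * w + 1) - p = 4 * p * w by rw [mul_add, mul_one, Nat.add_sub_cancel]; ring]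
    exact Nat.mul_div_cancel_left _ (by have := hp.pos; omega)
  have hq : 4 * ((3 * p - 1) / 4) + 1 = 3 * p := by omega
  rw [hdiv]
  have hM : 4 * (p ^ (j.succ + 1) * n + p * r + (3 * p - 1) / 4) + 1 =
      p ^ 2 * (4 * (p ^ (j.succ - 1) * n + w) + 1) := by
    rw [Nat.succ_eq_add_one, Nat.add_sub_cancel]
    linear_combination hq + p * hs
  have key := sum_thetaPairs_mul_sq hp3 hM
  refine (ZMod.intCast_eq_intCast_iff _ _ 3).1 ?_
  rw [Int.cast_mul, Int.cast_natCast, Int.cast_natCast, B_three_five_eq_sum, B_three_five_eq_sum,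
    key, Int.cast_mul]
end

section
/- Let t ∈ {3, 5, 7}, let k and n be positive integers, and let p be a prime number with p ≡ t (mod 8). Then B_{3,2}( p^{2k} n + (p^{2k} − 1)/8 ) ≡ (−1)^k · ((−2/p)_L)^k · B_{3,2}(n) (mod 3). -/
section Auxiliary

open PowerSeries PowerSeries.WithPiTopology Finset Filter

section Products

variable (R : Type*) [CommRing R] [TopologicalSpace R]

/-- The infinite product `∏ (1 - X ^ (c * i + d))` over `i : ℕ`. -/
noncomputable def progressionProd (c d : ℕ) : R⟦X⟧ :=
  ∏' i : ℕ, (1 - X ^ (c * i + d))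

theorem multipliable_progression {c d : ℕ} (hc : 0 < c) :
    Multipliable fun i : ℕ ↦ (1 : R⟦X⟧) - X ^ (c * i + d) := by
  nontriviality R
  simp_rw [sub_eq_add_neg]
  apply multipliable_one_add_of_tendsto_order_atTop_nhds_top
  refine ENat.tendsto_nhds_top_iff_natCast_lt.mpr
    (fun n ↦ Filter.eventually_atTop.mpr ⟨n + 1, fun m hm ↦ ?_⟩)
  rw [order_neg, order_X_pow]
  norm_cast
  nlinarith

theorem tendsto_progressionProd {c d : ℕ} (hc : 0 < c) :
    Tendsto (fun N ↦ ∏ i ∈ range N, ((1 : R⟦X⟧) - X ^ (c * i + d))) atTop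
      (nhds (progressionProd R c d)) :=
  (multipliable_progression R hc).hasProd.tendsto_prod_nat

variable [DiscreteTopology R]

theorem X_pow_dvd_progressionProd_sub {c d : ℕ} (hc : 0 < c) (hd : 0 < d) (N : ℕ) :
    (X : R⟦X⟧) ^ (N + 1) ∣
      progressionProd R c d - ∏ i ∈ range N, (1 - X ^ (c * i + d)) := by
  have key : ∀ M, (X : R⟦X⟧) ^ (N + 1) ∣
      ∏ i ∈ range (N + M), (1 - X ^ (c * i + d)) - ∏ i ∈ range N, (1 - X ^ (c * i + d)) := by
    intro M
    induction M with
    | zero => simp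
    | succ M ih =>
      rw [← add_assoc, prod_range_succ, mul_sub, mul_one, sub_right_comm]
      refine dvd_sub ih (Dvd.dvd.mul_left (pow_dvd_pow _ ?_) _)
      nlinarith
  rw [X_pow_dvd_iff]
  intro m hm
  have h1 := (tendsto_iff_coeff_tendsto _ _ _ _).1 (tendsto_progressionProd R (d := d) hc) m
  rw [nhds_discrete, tendsto_pure, eventually_atTop] at h1
  obtain ⟨M, hM⟩ := h1
  rw [map_sub, ← hM (N + M) (by omega), ← map_sub]
  exact X_pow_dvd_iff.1 (key M) m hm

theorem constantCoeff_progressionProd {c d : ℕ} (hc : 0 < c) (hd : 0 < d) :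
    constantCoeff (progressionProd R c d) = 1 := by
  have h := X_pow_dvd_iff.1 (X_pow_dvd_progressionProd_sub R hc hd 0) 0 (by simp)
  simpa [sub_eq_zero] using h

theorem progressionProd_ne_zero [Nontrivial R] {c d : ℕ} (hc : 0 < c) (hd : 0 < d) :
    progressionProd R c d ≠ 0 := fun h ↦ by
  simpa [h] using constantCoeff_progressionProd R hc hd

theorem progressionProd_eq_mul_two {c : ℕ} (d : ℕ) (hc : 0 < c) :
    progressionProd R c d = progressionProd R (2 * c) d * progressionProd R (2 * c) (c + d) := by
  have h2 : 0 < 2 * c := by omega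
  refine tendsto_nhds_unique ((tendsto_progressionProd R hc).comp
    (tendsto_id.const_mul_atTop' (r := 2) (by simp)))
    (((tendsto_progressionProd R h2).mul (tendsto_progressionProd R h2)).congr fun N ↦ ?_)
  simp only [Function.comp, id]
  induction N with
  | zero => simp
  | succ N ih =>
    rw [show 2 * (N + 1) = 2 * N + 1 + 1 by ring, prod_range_succ _ (2 * N + 1),
      prod_range_succ _ (2 * N), ← ih, prod_range_succ, prod_range_succ]
    ring_nf

theorem progressionProd_eq_mul_three {c : ℕ} (d : ℕ) (hc : 0 < c) :
    progressionProd R c d = progressionProd R (3 * c) d * progressionProd R (3 * c) (c + d) *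
      progressionProd R (3 * c) (2 * c + d) := by
  have h3 : 0 < 3 * c := by omega
  refine tendsto_nhds_unique ((tendsto_progressionProd R hc).comp
    (tendsto_id.const_mul_atTop' (r := 3) (by simp)))
    ((((tendsto_progressionProd R h3).mul (tendsto_progressionProd R h3)).mul
      (tendsto_progressionProd R h3)).congr fun N ↦ ?_)
  simp only [Function.comp, id]
  induction N with
  | zero => simp
  | succ N ih =>
    rw [show 3 * (N + 1) = 3 * N + 1 + 1 + 1 by ring, prod_range_succ _ (3 * N + 1 + 1),
      prod_range_succ _ (3 * N + 1), prod_range_succ _ (3 * N), ← ih, prod_range_succ,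
      prod_range_succ, prod_range_succ]
    ring_nf

end Products

section GaussBinomial

variable {R : Type*} [CommRing R]

/-- The Gaussian binomial coefficient with parameters `i + j` and `i`, evaluated at `Q`. -/
def gaussBinomial (Q : R) : ℕ → ℕ → R
  | 0, _ => 1
  | _ + 1, 0 => 1
  | i + 1, j + 1 => Q ^ (j + 1) * gaussBinomial Q i (j + 1) + gaussBinomial Q (i + 1) j

theorem gaussBinomial_zero_right (Q : R) (i : ℕ) : gaussBinomial Q i 0 = 1 := by
  cases i <;> simp [gaussBinomial]

theorem gaussBinomial_zero_left (Q : R) (j : ℕ) : gaussBinomial Q 0 j = 1 := by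
  simp [gaussBinomial]

theorem gaussBinomial_mul_prod (Q : R) (i j : ℕ) :
    gaussBinomial Q i j * (∏ k ∈ range i, (1 - Q ^ (k + 1))) * ∏ k ∈ range j, (1 - Q ^ (k + 1)) =
      ∏ k ∈ range (i + j), (1 - Q ^ (k + 1)) := by
  induction i generalizing j with
  | zero => simp [gaussBinomial_zero_left]
  | succ i ihi =>
    induction j with
    | zero => simp [gaussBinomial_zero_right]
    | succ j ihj =>
      have h1 := ihi (j + 1)
      rw [← add_assoc] at h1
      rw [show i + 1 + j = i + j + 1 by ring, prod_range_succ _ i, prod_range_succ _ (i + j)] at ihj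
      rw [show i + 1 + (j + 1) = i + j + 1 + 1 by ring, prod_range_succ _ (i + j + 1),
        prod_range_succ _ i, prod_range_succ _ j, gaussBinomial, prod_range_succ _ (i + j)]
      rw [prod_range_succ _ (i + j), prod_range_succ _ j] at h1
      linear_combination (Q ^ (j + 1) * (1 - Q ^ (i + 1))) * h1 + (1 - Q ^ (j + 1)) * ihj

theorem prod_add_mul_pow (Q x y : R) (L : ℕ) :
    ∏ i ∈ range L, (y + x * Q ^ i) =
      ∑ k ∈ antidiagonal L, Q ^ k.1.choose 2 * x ^ k.1 * y ^ k.2 * gaussBinomial Q k.1 k.2 := by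
  induction L with
  | zero => simp [gaussBinomial]
  | succ L ih =>
    let W : ℕ × ℕ → R := fun k ↦ Q ^ k.1.choose 2 * x ^ k.1 * y ^ k.2 * gaussBinomial Q k.1 k.2
    have hW : ∀ k ∈ antidiagonal (L + 1), W k =
        (if k.1 = 0 then 0 else x * Q ^ L * W (k.1 - 1, k.2)) +
          (if k.2 = 0 then 0 else y * W (k.1, k.2 - 1)) := by
      rintro ⟨i, j⟩ hk
      rw [HasAntidiagonal.mem_antidiagonal] at hk
      rcases i with _ | i <;> rcases j with _ | j
      · simp at hk
      · simp [W, gaussBinomial_zero_left, pow_succ']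
      · obtain rfl : i = L := by simpa using hk
        simp [W, gaussBinomial_zero_right, Nat.choose_succ_succ' i 1, pow_add]
        ring
      · obtain rfl : L = i + j + 1 := by simp at hk; omega
        simp [W, gaussBinomial, Nat.choose_succ_succ' i 1, pow_add]
        ring
    change _ = ∑ k ∈ antidiagonal (L + 1), W k
    rw [sum_congr rfl hW, sum_add_distrib, Nat.sum_antidiagonal_succ, Nat.sum_antidiagonal_succ',
      prod_range_succ, ih]
    simp only [Nat.add_sub_cancel, Nat.add_eq_zero_iff, one_ne_zero, and_false, if_false, if_true,
      zero_add, ← mul_sum, Prod.mk.eta]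
    ring

end GaussBinomial

section JacobiTripleProduct

theorem natAbs_le_of_two_mul_eq {a b : ℕ} {e : ℤ → ℕ} (ha : 0 < a) (hb : 0 < b)
    (he : ∀ n : ℤ, 2 * (e n : ℤ) = (a + b) * n ^ 2 + (b - a) * n) (n : ℤ) : n.natAbs ≤ e n := by
  zify
  rw [abs_le]
  have h := he n
  have h1 : (1 : ℤ) ≤ a := by exact_mod_cast ha
  have h2 : (1 : ℤ) ≤ b := by exact_mod_cast hb
  have h3 : 0 ≤ n ^ 2 - n := by
    rcases le_or_gt n 0 with h | h <;> nlinarith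
  have h4 : 0 ≤ n ^ 2 + n := by
    rcases le_or_gt 0 n with h | h <;> nlinarith
  constructor <;>
    nlinarith [mul_nonneg (sub_nonneg.2 h1) h3, mul_nonneg (sub_nonneg.2 h2) h4]

variable (R : Type*) [CommRing R]

theorem X_pow_dvd_progressionProd_mul_gaussBinomial_sub_one [TopologicalSpace R]
    [DiscreteTopology R] {s : ℕ} (hs : 0 < s) {i j N : ℕ}
    (hi : N ≤ i) (hj : N ≤ j) :
    (X : R⟦X⟧) ^ (N + 1) ∣ progressionProd R s s * gaussBinomial (X ^ s) i j - 1 := by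
  have hu : IsUnit (progressionProd R s s) := by
    rw [isUnit_iff_constantCoeff, constantCoeff_progressionProd R hs hs]
    exact isUnit_one
  have hP : ∀ m, N ≤ m → (Ideal.Quotient.mk (Ideal.span {(X : R⟦X⟧) ^ (N + 1)}))
      (∏ k ∈ range m, (1 - (X ^ s) ^ (k + 1))) =
        Ideal.Quotient.mk (Ideal.span {(X : R⟦X⟧) ^ (N + 1)}) (progressionProd R s s) := by
    intro m hm
    rw [eq_comm, Ideal.Quotient.eq, Ideal.mem_span_singleton]
    simp_rw [← pow_mul, mul_add_one]
    exact (pow_dvd_pow _ (by omega)).trans (X_pow_dvd_progressionProd_sub R hs hs m)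
  have h := congrArg (Ideal.Quotient.mk (Ideal.span {(X : R⟦X⟧) ^ (N + 1)}))
    (gaussBinomial_mul_prod ((X : R⟦X⟧) ^ s) i j)
  rw [map_mul, map_mul, hP i hi, hP j hj, hP (i + j) (by omega), ← map_mul, ← map_mul,
    Ideal.Quotient.eq, Ideal.mem_span_singleton] at h
  refine (hu.dvd_mul_left).1 (h.trans (dvd_of_eq ?_))
  ring

variable [IsDomain R] {a b : ℕ} {e : ℤ → ℕ}

theorem prod_mul_prod_eq_sum_gaussBinomial
    (he : ∀ n : ℤ, 2 * (e n : ℤ) = (a + b) * n ^ 2 + (b - a) * n) (N : ℕ) :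
    (∏ i ∈ range N, ((1 : R⟦X⟧) - X ^ ((a + b) * i + a))) *
        ∏ i ∈ range N, ((1 : R⟦X⟧) - X ^ ((a + b) * i + b)) =
      ∑ k ∈ antidiagonal (2 * N), (((k.1 - N : ℤ).negOnePow : ℤ) : R⟦X⟧) *
        X ^ e (k.1 - N) * gaussBinomial (X ^ (a + b)) k.1 k.2 := by
  have hE : ∀ N : ℕ, 2 * ((∑ j ∈ range N, (b + (a + b) * j) : ℕ) : ℤ) =
      2 * b * N + (a + b) * (N * (N - 1)) := by
    intro N
    induction N with
    | zero => simp
    | succ N ih =>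
      rw [sum_range_succ]
      push_cast at ih ⊢
      linear_combination ih
  have hC : ∀ k : ℕ, 2 * ((k.choose 2 : ℕ) : ℤ) = k * (k - 1) := by
    intro k
    induction k with
    | zero => simp
    | succ k ih =>
      rw [Nat.choose_succ_succ' k 1, Nat.choose_one_right]
      push_cast
      linear_combination ih
  set E := ∑ j ∈ range N, (b + (a + b) * j) + (a + b) * N * N with hEdef
  have hne : (-1 : R⟦X⟧) ^ N * X ^ E ≠ 0 :=
    mul_ne_zero (pow_ne_zero _ (by simp)) (pow_ne_zero _ X_ne_zero)
  apply mul_left_cancel₀ hne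
  have hq := prod_add_mul_pow ((X : R⟦X⟧) ^ (a + b)) (-X ^ b) (X ^ ((a + b) * N)) (2 * N)
  rw [two_mul, prod_range_add, ← prod_range_reflect, ← two_mul] at hq
  have hconst : ∀ z : R⟦X⟧, z ^ N = ∏ _i ∈ range N, z := by simp
  have h1 : ∏ j ∈ range N, ((X : R⟦X⟧) ^ ((a + b) * N) + -X ^ b * (X ^ (a + b)) ^ (N - 1 - j)) =
      (-1) ^ N * X ^ (∑ j ∈ range N, (b + (a + b) * j)) *
        ∏ i ∈ range N, (1 - X ^ ((a + b) * i + a)) := by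
    rw [← prod_pow_eq_pow_sum, ← prod_range_reflect (fun j ↦ (X : R⟦X⟧) ^ (b + (a + b) * j)),
      hconst, ← prod_mul_distrib, ← prod_mul_distrib]
    refine prod_congr rfl fun i hi ↦ ?_
    obtain ⟨m, rfl⟩ : ∃ m, N = i + 1 + m := ⟨N - (i + 1), by have := mem_range.1 hi; omega⟩
    rw [show i + 1 + m - 1 - i = m by omega]
    ring
  have h2 : ∏ x ∈ range N, ((X : R⟦X⟧) ^ ((a + b) * N) + -X ^ b * (X ^ (a + b)) ^ (N + x)) =
      X ^ ((a + b) * N * N) * ∏ i ∈ range N, (1 - X ^ ((a + b) * i + b)) := by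
    rw [pow_mul (X : R⟦X⟧) ((a + b) * N) N, hconst (X ^ ((a + b) * N)), ← prod_mul_distrib]
    exact prod_congr rfl fun i _ ↦ by ring
  rw [h1, h2] at hq
  calc _ = _ := by rw [hEdef, pow_add]; ring
    _ = _ := hq
    _ = _ := by
      rw [mul_sum]
      refine sum_congr rfl fun k hk ↦ ?_
      rw [HasAntidiagonal.mem_antidiagonal] at hk
      have hk' : (k.2 : ℤ) = 2 * N - k.1 := by omega
      have hexp : (a + b) * k.1.choose 2 + b * k.1 + (a + b) * N * k.2 = E + e (k.1 - N) := by
        zify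
        rw [hk', hEdef]
        have h3 := hE N
        have h4 := hC k.1
        have h5 := he (k.1 - N)
        push_cast at h3 ⊢
        apply mul_left_cancel₀ (two_ne_zero (α := ℤ))
        linear_combination (a + b : ℤ) * h4 - h3 - h5
      have hsign : (-1 : R⟦X⟧) ^ k.1 =
          (-1) ^ N * (((k.1 - N : ℤ).negOnePow : ℤ) : R⟦X⟧) := by
        have : ((k.1 : ℤ).negOnePow : ℤ) =
            ((N : ℤ).negOnePow : ℤ) * ((k.1 - N : ℤ).negOnePow : ℤ) := by
          rw [← Units.val_mul, ← Int.negOnePow_add]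
          congr 2
          ring
        have h := congrArg (Int.cast : ℤ → R⟦X⟧) this
        simpa [Int.negOnePow] using h
      generalize gaussBinomial ((X : R⟦X⟧) ^ (a + b)) k.1 k.2 = g
      calc _ = (-1 : R⟦X⟧) ^ k.1 *
            X ^ ((a + b) * k.1.choose 2 + b * k.1 + (a + b) * N * k.2) * g := by
            rw [neg_pow]; ring
        _ = _ := by rw [hexp, hsign, pow_add]; ring

variable [TopologicalSpace R] [DiscreteTopology R]

theorem hasSum_jacobi (ha : 0 < a) (hb : 0 < b)
    (he : ∀ n : ℤ, 2 * (e n : ℤ) = (a + b) * n ^ 2 + (b - a) * n) :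
    HasSum (fun n : ℤ ↦ ((n.negOnePow : ℤ) : R⟦X⟧) * X ^ e n)
      (progressionProd R (a + b) (a + b) *
        (progressionProd R (a + b) a * progressionProd R (a + b) b)) := by
  have hs : 0 < a + b := by omega
  have he' := natAbs_le_of_two_mul_eq ha hb he
  have key : ∀ N : ℕ, (X : R⟦X⟧) ^ (N + 1) ∣ progressionProd R (a + b) (a + b) *
      (progressionProd R (a + b) a * progressionProd R (a + b) b) -
        ∑ n ∈ Icc (-N : ℤ) N, ((n.negOnePow : ℤ) : R⟦X⟧) * X ^ e n := by
    intro N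
    have hsum : ∑ n ∈ Icc (-N : ℤ) N, ((n.negOnePow : ℤ) : R⟦X⟧) * X ^ e n =
        ∑ k ∈ antidiagonal (2 * N), (((k.1 - N : ℤ).negOnePow : ℤ) : R⟦X⟧) * X ^ e (k.1 - N) := by
      symm
      refine sum_nbij' (fun k ↦ (k.1 - N : ℤ)) (fun n ↦ ((n + N).toNat, (N - n).toNat))
        ?_ ?_ ?_ ?_ ?_
      · intro k hk
        simp only [HasAntidiagonal.mem_antidiagonal, mem_Icc] at *
        omega
      · intro k hk
        simp only [HasAntidiagonal.mem_antidiagonal, mem_Icc] at *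
        omega
      · intro k hk
        simp only [HasAntidiagonal.mem_antidiagonal] at *
        ext <;> simp
        omega
      · intro k hk
        simp only [mem_Icc] at *
        omega
      · intro k hk
        rfl
    have hfin := prod_mul_prod_eq_sum_gaussBinomial R he N
    have hA := X_pow_dvd_progressionProd_sub R hs ha N
    have hB := X_pow_dvd_progressionProd_sub R hs hb N
    have hG : (X : R⟦X⟧) ^ (N + 1) ∣ progressionProd R (a + b) (a + b) *
        ((∏ i ∈ range N, ((1 : R⟦X⟧) - X ^ ((a + b) * i + a))) *
          ∏ i ∈ range N, ((1 : R⟦X⟧) - X ^ ((a + b) * i + b))) -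
        ∑ n ∈ Icc (-N : ℤ) N, ((n.negOnePow : ℤ) : R⟦X⟧) * X ^ e n := by
      rw [hfin, hsum, mul_sum, ← sum_sub_distrib]
      refine dvd_sum fun k hk ↦ ?_
      rw [HasAntidiagonal.mem_antidiagonal] at hk
      have hmin := X_pow_dvd_progressionProd_mul_gaussBinomial_sub_one R hs
        (min_le_left k.1 k.2) (min_le_right k.1 k.2)
      have hle : N + 1 ≤ e (k.1 - N) + (min k.1 k.2 + 1) := by
        have := he' (k.1 - N)
        omega
      refine (pow_dvd_pow _ hle).trans ?_
      rw [pow_add]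
      exact (mul_dvd_mul_left _ hmin).trans
        ⟨(((k.1 - N : ℤ).negOnePow : ℤ) : R⟦X⟧), by ring⟩
    have hAB := dvd_add (hA.mul_left
        (progressionProd R (a + b) (a + b) * progressionProd R (a + b) b))
      (hB.mul_left (progressionProd R (a + b) (a + b) *
        ∏ i ∈ range N, ((1 : R⟦X⟧) - X ^ ((a + b) * i + a))))
    refine (dvd_add hAB hG).trans (dvd_of_eq ?_)
    ring
  rw [hasSum_iff_hasSum_coeff]
  intro d
  have h := X_pow_dvd_iff.1 (key d) d (by simp)
  rw [map_sub, sub_eq_zero, map_sum] at h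
  rw [h]
  refine hasSum_sum_of_ne_finset_zero fun n hn ↦ ?_
  have hd : ¬ e n ≤ d := fun hd ↦ hn <| by
    have := he' n
    rw [mem_Icc]
    omega
  rw [coeff_mul_X_pow', if_neg hd]

end JacobiTripleProduct

section ThetaProducts

theorem eq_mul_of_hasSum_ite {R α : Type*} [CommRing R] [TopologicalSpace R] [DiscreteTopology R]
    {s : α → R} {E : α → ℕ} {N M : ℕ} {A B : R}
    (hN : HasSum (fun x ↦ if N = E x then s x else 0) A)
    (hM : HasSum (fun x ↦ if M = E x then s x else 0) B)
    (ι : α → α) (hι : Function.Injective ι) (ε : R) (hs : ∀ x, s (ι x) = ε * s x)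
    (hE : ∀ x, M = E (ι x) ↔ N = E x) (hr : ∀ y, M = E y → y ∈ Set.range ι) : B = ε * A := by
  rw [← hι.hasSum_iff] at hM
  · refine hM.unique ((hN.mul_left ε).congr_fun ?_)
    intro x
    simp [hE, hs]
  · intro y hy
    rw [if_neg fun h ↦ hy (hr y h)]

variable (R : Type*) [CommRing R] [TopologicalSpace R] [DiscreteTopology R]

theorem progressionProd_one_mul_two_eq :
    progressionProd R 1 1 * progressionProd R 2 2 =
      (progressionProd R (1 + 2) (1 + 2) *
          (progressionProd R (1 + 2) 1 * progressionProd R (1 + 2) 2)) *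
        (progressionProd R (2 + 4) (2 + 4) *
          (progressionProd R (2 + 4) 2 * progressionProd R (2 + 4) 4)) := by
  rw [progressionProd_eq_mul_three R 1 one_pos, progressionProd_eq_mul_three R 2 two_pos]
  norm_num
  ring

theorem progressionProd_one_mul_two_eq' :
    progressionProd R 1 1 * progressionProd R 2 2 =
      (progressionProd R (1 + 3) (1 + 3) *
          (progressionProd R (1 + 3) 1 * progressionProd R (1 + 3) 3)) *
        (progressionProd R (2 + 2) (2 + 2) *
          (progressionProd R (2 + 2) 2 * progressionProd R (2 + 2) 2)) := by
  rw [progressionProd_eq_mul_two R 1 one_pos, progressionProd_eq_mul_two R (c := 2) 2 two_pos]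
  norm_num
  rw [progressionProd_eq_mul_two R 1 two_pos, progressionProd_eq_mul_two R (c := 2) 2 two_pos]
  norm_num
  ring

variable [IsDomain R]

theorem hasSum_coeff_mul_jacobi {a b c d : ℕ} {e₁ e₂ : ℤ → ℕ}
    (ha : 0 < a) (hb : 0 < b) (hc : 0 < c) (hd : 0 < d)
    (he₁ : ∀ n : ℤ, 2 * (e₁ n : ℤ) = (a + b) * n ^ 2 + (b - a) * n)
    (he₂ : ∀ n : ℤ, 2 * (e₂ n : ℤ) = (c + d) * n ^ 2 + (d - c) * n) (N : ℕ) :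
    HasSum (fun x : ℤ × ℤ ↦
        if N = e₁ x.1 + e₂ x.2 then (((x.1 + x.2).negOnePow : ℤ) : R) else 0)
      (coeff N ((progressionProd R (a + b) (a + b) *
          (progressionProd R (a + b) a * progressionProd R (a + b) b)) *
        (progressionProd R (c + d) (c + d) *
          (progressionProd R (c + d) c * progressionProd R (c + d) d)))) := by
  have h₁ := natAbs_le_of_two_mul_eq ha hb he₁
  have h₂ := natAbs_le_of_two_mul_eq hc hd he₂
  have hterm : ∀ (x : ℤ × ℤ) (M : ℕ), coeff M (((x.1.negOnePow : ℤ) : R⟦X⟧) * X ^ e₁ x.1 *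
      (((x.2.negOnePow : ℤ) : R⟦X⟧) * X ^ e₂ x.2)) =
        if M = e₁ x.1 + e₂ x.2 then (((x.1 + x.2).negOnePow : ℤ) : R) else 0 := by
    intro x M
    rw [Int.negOnePow_add, Units.val_mul, Int.cast_mul]
    rw [show ((x.1.negOnePow : ℤ) : R⟦X⟧) * X ^ e₁ x.1 * (((x.2.negOnePow : ℤ) : R⟦X⟧) * X ^ e₂ x.2)
      = C (((x.1.negOnePow : ℤ) : R) * ((x.2.negOnePow : ℤ) : R)) * X ^ (e₁ x.1 + e₂ x.2) by
        rw [map_mul, map_intCast, map_intCast, pow_add]; ring]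
    rw [coeff_C_mul, coeff_X_pow, mul_ite, mul_one, mul_zero]
  have hsummable : Summable fun x : ℤ × ℤ ↦ ((x.1.negOnePow : ℤ) : R⟦X⟧) * X ^ e₁ x.1 *
      (((x.2.negOnePow : ℤ) : R⟦X⟧) * X ^ e₂ x.2) := by
    rw [summable_iff_summable_coeff]
    intro M
    refine summable_of_ne_finset_zero (s := Icc (-M : ℤ) M ×ˢ Icc (-M : ℤ) M) fun x hx ↦ ?_
    rw [hterm, if_neg]
    intro hM
    apply hx
    have := h₁ x.1
    have := h₂ x.2
    simp only [mem_product, mem_Icc]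
    omega
  have h := ((hasSum_iff_hasSum_coeff R).1
    ((hasSum_jacobi R ha hb he₁).mul (hasSum_jacobi R hc hd he₂) hsummable)) N
  simpa only [hterm] using h

variable {R}

theorem coeff_eq_of_mod_eight_eq_five {p : ℕ} (hp : p.Prime) (h8 : p % 8 = 5) {N M : ℕ}
    (hNM : 8 * M + 1 = p ^ 2 * (8 * N + 1)) :
    coeff M (progressionProd R 1 1 * progressionProd R 2 2) =
      coeff N (progressionProd R 1 1 * progressionProd R 2 2) := by
  have : Fact p.Prime := ⟨hp⟩
  have he₁ : ∀ n : ℤ, 2 * ((n * (3 * n + 1) / 2).toNat : ℤ) =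
      ((1 : ℕ) + (2 : ℕ)) * n ^ 2 + ((2 : ℕ) - (1 : ℕ)) * n := by
    intro n
    have h2 : 2 ∣ n * (3 * n + 1) := by
      rcases Int.even_or_odd' n with ⟨k, rfl | rfl⟩
      · exact ⟨k * (3 * (2 * k) + 1), by ring⟩
      · exact ⟨(2 * k + 1) * (3 * k + 2), by ring⟩
    have h0 : 0 ≤ n * (3 * n + 1) := by rcases le_or_gt 0 n with h | h <;> nlinarith
    rw [Int.toNat_of_nonneg (Int.ediv_nonneg h0 (by norm_num)), Int.mul_ediv_cancel' h2]
    push_cast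
    ring
  have he₂ : ∀ n : ℤ, 2 * ((n * (3 * n + 1)).toNat : ℤ) =
      ((2 : ℕ) + (4 : ℕ)) * n ^ 2 + ((4 : ℕ) - (2 : ℕ)) * n := by
    intro n
    have h0 : 0 ≤ n * (3 * n + 1) := by rcases le_or_gt 0 n with h | h <;> nlinarith
    rw [Int.toNat_of_nonneg h0]
    push_cast
    ring
  have h := hasSum_coeff_mul_jacobi R one_pos two_pos two_pos four_pos he₁ he₂
  rw [← progressionProd_one_mul_two_eq] at h
  obtain ⟨c, hc⟩ : ∃ c : ℤ, 6 * c + 1 = p ∨ 6 * c + 1 = -p := by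
    have h3 : p % 3 ≠ 0 := fun h3 ↦ by
      rw [← Nat.dvd_iff_mod_eq_zero, Nat.prime_dvd_prime_iff_eq Nat.prime_three hp] at h3
      omega
    rcases (by omega : p % 6 = 1 ∨ p % 6 = 5) with h6 | h6
    · exact ⟨(p - 1) / 6, by omega⟩
    · exact ⟨-((p + 1) / 6), by omega⟩
  have hsq : (6 * c + 1) ^ 2 = (p : ℤ) ^ 2 := by rcases hc with hc | hc <;> rw [hc]; ring
  have hp0 : (p : ℤ) ≠ 0 := by exact_mod_cast hp.ne_zero
  have hc0 : 6 * c + 1 ≠ 0 := by omega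
  have hdvd : ∀ x : ℤ, (p : ℤ) ∣ x → (6 * c + 1) ∣ x := by
    intro x hx
    rcases hc with hc | hc <;> rw [hc]
    · exact hx
    · exact (neg_dvd).2 hx
  have hE : ∀ (K : ℕ) (x : ℤ × ℤ),
      K = (x.1 * (3 * x.1 + 1) / 2).toNat + (x.2 * (3 * x.2 + 1)).toNat ↔
        3 * (8 * (K : ℤ) + 1) = (6 * x.1 + 1) ^ 2 + 2 * (6 * x.2 + 1) ^ 2 := by
    intro K x
    have h1 := he₁ x.1
    have h2 := he₂ x.2
    push_cast at h1 h2
    zify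
    constructor <;> intro h <;> nlinarith
  have hNM' : 8 * (M : ℤ) + 1 = p ^ 2 * (8 * N + 1) := by exact_mod_cast hNM
  have hkey := eq_mul_of_hasSum_ite (h N) (h M)
    (fun x ↦ ((6 * c + 1) * x.1 + c, (6 * c + 1) * x.2 + c)) ?_ 1 ?_ ?_ ?_
  · rwa [one_mul] at hkey
  · intro x y hxy
    simp only [Prod.mk.injEq, add_left_inj, mul_right_inj' hc0] at hxy
    exact Prod.ext hxy.1 hxy.2
  · intro x
    rw [one_mul]
    congr 2
    rw [Int.negOnePow_eq_iff]
    exact ⟨3 * c * (x.1 + x.2) + c, by ring⟩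
  · intro x
    rw [hE, hE, hNM']
    have : (6 * ((6 * c + 1) * x.1 + c) + 1) ^ 2 + 2 * (6 * ((6 * c + 1) * x.2 + c) + 1) ^ 2 =
        (p : ℤ) ^ 2 * ((6 * x.1 + 1) ^ 2 + 2 * (6 * x.2 + 1) ^ 2) := by
      rw [← hsq]; ring
    rw [this, mul_left_comm, mul_right_inj' (pow_ne_zero 2 hp0)]
  · intro y hy
    rw [hE, hNM'] at hy
    have hleg : legendreSym p (-2) = -1 := by
      rw [legendreSym.at_neg_two (by omega), ZMod.χ₈'_nat_eq_if_mod_eight]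
      simp [h8]
      omega
    obtain ⟨hx1, hx2⟩ := legendreSym.prime_dvd_of_eq_neg_one hleg
      (x := 6 * y.1 + 1) (y := 6 * y.2 + 1)
      ⟨p * (3 * (8 * N + 1)), by linear_combination -hy⟩
    obtain ⟨u, hu⟩ := hdvd _ hx1
    obtain ⟨v, hv⟩ := hdvd _ hx2
    have key : ∀ {z w : ℤ}, 6 * z + 1 = (6 * c + 1) * w → ∃ m, (6 * c + 1) * m + c = z := by
      intro z w hzw
      have : (6 : ℤ) ∣ w - 1 := ⟨z - c * w, by linear_combination -hzw⟩
      obtain ⟨m, hm⟩ := this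
      obtain rfl : w = 6 * m + 1 := by linarith
      exact ⟨m, by linarith⟩
    obtain ⟨m, hm⟩ := key hu
    obtain ⟨n, hn⟩ := key hv
    exact ⟨(m, n), Prod.ext hm hn⟩

theorem coeff_eq_of_mod_four_eq_three {p : ℕ} (hp : p.Prime) {c : ℕ} (hc : p + 1 = 4 * c)
    {N M : ℕ} (hNM : 8 * M + 1 = p ^ 2 * (8 * N + 1)) :
    coeff M (progressionProd R 1 1 * progressionProd R 2 2) =
      (-1) ^ c * coeff N (progressionProd R 1 1 * progressionProd R 2 2) := by
  have : Fact p.Prime := ⟨hp⟩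
  have he₁ : ∀ n : ℤ, 2 * ((n * (2 * n + 1)).toNat : ℤ) =
      ((1 : ℕ) + (3 : ℕ)) * n ^ 2 + ((3 : ℕ) - (1 : ℕ)) * n := by
    intro n
    have h0 : 0 ≤ n * (2 * n + 1) := by rcases le_or_gt 0 n with h | h <;> nlinarith
    rw [Int.toNat_of_nonneg h0]
    push_cast
    ring
  have he₂ : ∀ n : ℤ, 2 * ((2 * n ^ 2).toNat : ℤ) =
      ((2 : ℕ) + (2 : ℕ)) * n ^ 2 + ((2 : ℕ) - (2 : ℕ)) * n := by
    intro n
    rw [Int.toNat_of_nonneg (by positivity)]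
    push_cast
    ring
  have h := hasSum_coeff_mul_jacobi R one_pos three_pos two_pos two_pos he₁ he₂
  rw [← progressionProd_one_mul_two_eq'] at h
  have hp' : (p : ℤ) = 4 * c - 1 := by omega
  have hp0 : (p : ℤ) ≠ 0 := by exact_mod_cast hp.ne_zero
  have hE : ∀ (K : ℕ) (x : ℤ × ℤ),
      K = (x.1 * (2 * x.1 + 1)).toNat + (2 * x.2 ^ 2).toNat ↔
        8 * (K : ℤ) + 1 = (4 * x.1 + 1) ^ 2 + (4 * x.2) ^ 2 := by
    intro K x
    have h1 := he₁ x.1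
    have h2 := he₂ x.2
    push_cast at h1 h2
    zify
    constructor <;> intro h <;> nlinarith
  have hNM' : 8 * (M : ℤ) + 1 = p ^ 2 * (8 * N + 1) := by exact_mod_cast hNM
  refine eq_mul_of_hasSum_ite (h N) (h M) (fun x ↦ (-p * x.1 - c, p * x.2)) ?_ _ ?_ ?_ ?_
  · intro x y hxy
    simp only [Prod.mk.injEq, sub_left_inj, mul_right_inj' hp0,
      mul_right_inj' (neg_ne_zero.2 hp0)] at hxy
    exact Prod.ext hxy.1 hxy.2
  · intro x
    have : (-p * x.1 - c + p * x.2).negOnePow = (c : ℤ).negOnePow * (x.1 + x.2).negOnePow := by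
      rw [← Int.negOnePow_add, Int.negOnePow_eq_iff, hp']
      exact ⟨-2 * c * x.1 - c + 2 * c * x.2 - x.2, by ring⟩
    rw [this]
    simp [Int.negOnePow]
  · intro x
    rw [hE, hE, hNM']
    have : (4 * (-p * x.1 - c) + 1) ^ 2 + (4 * (p * x.2)) ^ 2 =
        (p : ℤ) ^ 2 * ((4 * x.1 + 1) ^ 2 + (4 * x.2) ^ 2) := by
      rw [hp']; ring
    rw [this, mul_right_inj' (pow_ne_zero 2 hp0)]
  · intro y hy
    rw [hE, hNM'] at hy
    have hleg : legendreSym p (-1) = -1 := by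
      rw [legendreSym.at_neg_one (by omega), ZMod.χ₄_nat_three_mod_four (by omega)]
    obtain ⟨⟨u, hu⟩, hx2⟩ := legendreSym.prime_dvd_of_eq_neg_one hleg
      (x := 4 * y.1 + 1) (y := 4 * y.2)
      ⟨p * (8 * N + 1), by linear_combination -hy⟩
    have hcop : IsCoprime (p : ℤ) 4 := ⟨-1, c, by rw [hp']; ring⟩
    obtain ⟨v, hv⟩ := hcop.dvd_of_dvd_mul_left hx2
    have : (4 : ℤ) ∣ -u - 1 := ⟨y.1 - c * u, by rw [hp'] at hu; linear_combination -hu⟩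
    obtain ⟨m, hm⟩ := this
    obtain rfl : u = -(4 * m + 1) := by linarith
    refine ⟨(m, v), Prod.ext ?_ hv.symm⟩
    change -p * m - c = y.1
    rw [hp'] at hu ⊢
    linarith

end ThetaProducts

section GeneratingFunction

theorem regularPartitionCount_eq_card_restricted (t n : ℕ) :
    regularPartitionCount t n = #(Nat.Partition.restricted n (¬ t ∣ ·)) := by
  rw [regularPartitionCount, Nat.card_eq_fintype_card, Fintype.card_subtype]
  rfl

variable (R : Type*) [CommRing R] [IsDomain R] [TopologicalSpace R] [DiscreteTopology R]

theorem mk_regularPartitionCount_mul {t : ℕ} (ht : 0 < t) :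
    mk (fun n ↦ (regularPartitionCount t n : R)) * progressionProd R 1 1 =
      progressionProd R t t := by
  have hprod : progressionProd R t t = ∏' i : ℕ, (1 - X ^ ((i + 1) * t)) :=
    tprod_congr fun i ↦ by rw [add_one_mul, mul_comm]
  rw [hprod, progressionProd]
  simp_rw [regularPartitionCount_eq_card_restricted]
  rw [Nat.Partition.powerSeriesMk_card_restricted_eq_tprod R (¬ t ∣ ·),
    ← (Nat.Partition.multipliable_powerSeriesMk_card_restricted R (¬ t ∣ ·)).tprod_mul
      (multipliable_progression R one_pos)]
  simp_rw [one_mul, ite_not, ite_mul, pow_mul]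
  conv in fun b ↦ _ =>
    ext b
    rw [tsum_pow_mul_one_sub_of_constantCoeff_eq_zero (by simp)]
  refine tprod_eq_tprod_of_ne_one_bij (fun i ↦ (i.val + 1) * t - 1) ?_ ?_ ?_
  · intro x y h
    rw [tsub_left_inj (by nlinarith) (by nlinarith), mul_left_inj' ht.ne', add_left_inj] at h
    exact SetCoe.ext h
  · suffices ∀ i : ℕ, t ∣ i + 1 → ∃ j ≠ 0, j * t - 1 = i by simpa
    intro i hi
    obtain ⟨j, hj⟩ := dvd_def.mp hi
    refine ⟨j, by grind, Nat.sub_eq_of_eq_add ?_⟩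
    rw [hj, mul_comm t j]
  · intro i
    have : (i + 1) * t - 1 + 1 = (i + 1) * t := by grind
    simp [this, pow_mul]

theorem mk_B_mul {u v : ℕ} (hu : 0 < u) (hv : 0 < v) :
    mk (fun n ↦ (B u v n : R)) * progressionProd R 1 1 ^ 2 =
      progressionProd R u u * progressionProd R v v := by
  have : mk (fun n ↦ (B u v n : R)) = mk (fun n ↦ (regularPartitionCount u n : R)) *
      mk (fun n ↦ (regularPartitionCount v n : R)) := by
    ext n
    simp [coeff_mul, B, Nat.sum_antidiagonal_eq_sum_range_succ_mk]
  rw [this, ← mk_regularPartitionCount_mul R hu, ← mk_regularPartitionCount_mul R hv]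
  ring

theorem mk_B_three_two :
    mk (fun n ↦ (B 3 2 n : ZMod 3)) =
      progressionProd (ZMod 3) 1 1 * progressionProd (ZMod 3) 2 2 := by
  have hcube : progressionProd (ZMod 3) 1 1 ^ 3 = progressionProd (ZMod 3) 3 3 := by
    rw [progressionProd, ← (multipliable_progression (ZMod 3) one_pos).tprod_pow]
    refine tprod_congr fun i ↦ ?_
    have h3 : (3 : (ZMod 3)⟦X⟧) = 0 := by
      have : ((3 : ℕ) : (ZMod 3)⟦X⟧) = C ((3 : ℕ) : ZMod 3) := (map_natCast C 3).symm
      rw [ZMod.natCast_self, map_zero] at this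
      exact_mod_cast this
    linear_combination (X ^ (2 * (i + 1)) - X ^ (i + 1)) * h3
  apply mul_right_cancel₀ (pow_ne_zero 2 (progressionProd_ne_zero (ZMod 3) one_pos one_pos))
  rw [mk_B_mul _ three_pos two_pos, ← hcube]
  ring

end GeneratingFunction

theorem B_three_two_prime_sq {p : ℕ} [Fact p.Prime] (h8 : p % 8 = 3 ∨ p % 8 = 5 ∨ p % 8 = 7)
    {N M : ℕ} (hNM : 8 * M + 1 = p ^ 2 * (8 * N + 1)) :
    (B 3 2 M : ZMod 3) = -(legendreSym p (-2) : ZMod 3) * B 3 2 N := by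
  have hp : p.Prime := Fact.out
  have hB : ∀ n, (B 3 2 n : ZMod 3) =
      coeff n (progressionProd (ZMod 3) 1 1 * progressionProd (ZMod 3) 2 2) := by
    intro n
    rw [← mk_B_three_two, coeff_mk]
  have hleg : legendreSym p (-2) = if p % 8 = 3 then 1 else -1 := by
    rw [legendreSym.at_neg_two (by omega), ZMod.χ₈'_nat_eq_if_mod_eight]
    grind
  rw [hB, hB, hleg]
  by_cases h5 : p % 8 = 5
  · rw [coeff_eq_of_mod_eight_eq_five hp h5 hNM]
    simp [h5]
  · have hc : p + 1 = 4 * ((p + 1) / 4) := by omega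
    rw [coeff_eq_of_mod_four_eq_three hp hc hNM]
    rcases (by omega : p % 8 = 3 ∨ p % 8 = 7) with h | h
    · rw [Odd.neg_one_pow (by rw [Nat.odd_iff]; omega)]
      simp [h]
    · rw [Even.neg_one_pow (by rw [Nat.even_iff]; omega)]
      simp [h]

end Auxiliary

/-- Corollary 1.6(iii). -/
theorem B_3_2_cor (t : ℕ) (ht : t = 3 ∨ t = 5 ∨ t = 7) (k n : ℕ) (hk : 0 < k) (hn : 0 < n)
    (p : ℕ) (hp : p.Prime) (hpt : p % 8 = t) :
    (B 3 2 (p ^ (2 * k) * n + (p ^ (2 * k) - 1) / 8) : ℤ)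
      ≡ (-1) ^ k * (@legendreSym p ⟨hp⟩ (-2)) ^ k * (B 3 2 n : ℤ) [ZMOD 3] := by
  have : Fact p.Prime := ⟨hp⟩
  have hp8 : p % 8 = 3 ∨ p % 8 = 5 ∨ p % 8 = 7 := hpt ▸ ht
  have hsq : ∀ k, p ^ (2 * k) % 8 = 1 := by
    intro k
    have h2 : p ^ 2 % 8 = 1 := by rcases hp8 with h | h | h <;> simp [Nat.pow_mod, h]
    rw [pow_mul, Nat.pow_mod, h2, one_pow, Nat.one_mod]
  have hidx : ∀ k, 8 * (p ^ (2 * k) * n + (p ^ (2 * k) - 1) / 8) + 1 =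
      p ^ (2 * k) * (8 * n + 1) := by
    intro k
    have h := hsq k
    have h' : 8 * ((p ^ (2 * k) - 1) / 8) + 1 = p ^ (2 * k) := by omega
    linear_combination h'
  have hmain : (B 3 2 (p ^ (2 * k) * n + (p ^ (2 * k) - 1) / 8) : ZMod 3) =
      (-(legendreSym p (-2) : ZMod 3)) ^ k * B 3 2 n := by
    clear hk
    induction k with
    | zero => simp
    | succ k ih =>
      rw [B_three_two_prime_sq (N := p ^ (2 * k) * n + (p ^ (2 * k) - 1) / 8) hp8, ih]
      · ring
      · rw [hidx (k + 1), hidx k]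
        ring
  apply (ZMod.intCast_eq_intCast_iff _ _ 3).1
  push_cast
  rw [hmain, neg_pow]
end
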